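/- Let τ > 0, let p ≥ 1 be an integer, let a = (a_1,…,a_p) ∈ ℝ^p with a_j ∉ {−mτ − n : m, n ∈ ℤ≥0} for every j, let b = (b_1,…,b_p) ∈ (0,∞)^p, and suppose Σ_{j=1}^p (b_j − a_j) > 0. For each integer n ≥ 0 set c_n := ∏_{j=1}^p ∏_{k=0}^{n−1} Γ((a_j + k)/τ) / Γ((b_j + k)/τ), where Γ is the Euler gamma function. Then the power series Σ_{n≥0} c_n·x^n has infinite radius of convergence; in particular f(x) := Σ_{n≥0} c_n·x^n defines an entire function of x ∈ ℂ. -/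

import Mathlib

open Complex Filter Set

noncomputable section

lemma log_Gamma_add_one_sub {x : ℝ} (hx : 0 < x) :
    Real.log (Real.Gamma (x + 1)) - Real.log (Real.Gamma x) = Real.log x := by
  rw [Real.Gamma_add_one hx.ne', Real.log_mul hx.ne' (Real.Gamma_pos_of_pos hx).ne',
    add_sub_cancel_right]

lemma log_Gamma_sub_le_of_lt {u v : ℝ} (hu : 0 < u) (huv : u < v) :
    Real.log (Real.Gamma v) - Real.log (Real.Gamma u) ≤ (v - u) * Real.log v := by
  have hv := hu.trans huv
  have h := Real.convexOn_log_Gamma.slope_mono_adjacent (x := u) (y := v) (z := v + 1)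
    hu (hv.trans (lt_add_one v)) huv (lt_add_one v)
  simp only [Function.comp_apply, add_sub_cancel_left, div_one, log_Gamma_add_one_sub hv] at h
  rwa [div_le_iff₀ (sub_pos.2 huv), mul_comm] at h

lemma le_log_Gamma_sub_of_lt {u v : ℝ} (hu : 1 < u) (huv : u < v) :
    (v - u) * Real.log (u - 1) ≤ Real.log (Real.Gamma v) - Real.log (Real.Gamma u) := by
  have hu' : 0 < u - 1 := sub_pos.2 hu
  have h := Real.convexOn_log_Gamma.slope_mono_adjacent (x := u - 1) (y := u) (z := v)
    hu' (by simp only [mem_Ioi]; linarith) (sub_one_lt u) huv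
  have hlog := log_Gamma_add_one_sub hu'
  rw [sub_add_cancel] at hlog
  simp only [Function.comp_apply, sub_sub_cancel, div_one, hlog] at h
  rwa [le_div_iff₀ (sub_pos.2 huv), mul_comm] at h

lemma exists_abs_log_affine_sub_log_le {τ : ℝ} (hτ : 0 < τ) (β : ℝ) :
    ∃ C : ℝ, ∀ᶠ n : ℕ in atTop, |Real.log ((β + n) / τ) - Real.log n| ≤ C := by
  have h : Tendsto (fun n : ℕ => (β / n + 1) / τ) atTop (nhds ((0 + 1) / τ)) :=
    ((tendsto_const_div_atTop_nhds_zero_nat β).add_const 1).div_const τ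
  have hlog := (h.log (by positivity)).abs
  refine ⟨|Real.log ((0 + 1) / τ)| + 1, ?_⟩
  filter_upwards [hlog.eventually_le_const (lt_add_one _), eventually_gt_atTop 0,
    (tendsto_atTop_add_const_left _ β tendsto_natCast_atTop_atTop).eventually_gt_atTop (0 : ℝ)]
    with n hle hn hβ
  have hn' : (0 : ℝ) < n := Nat.cast_pos.2 hn
  rw [← Real.log_div (div_pos hβ hτ).ne' hn'.ne']
  have he : (β + n) / τ / n = (β / n + 1) / τ := by field_simp
  rwa [he]

lemma exists_log_Gamma_sub_le {τ : ℝ} (hτ : 0 < τ) (a b : ℝ) :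
    ∃ C : ℝ, ∀ᶠ n : ℕ in atTop,
      Real.log (Real.Gamma ((a + n) / τ)) - Real.log (Real.Gamma ((b + n) / τ)) ≤
        (a - b) / τ * Real.log n + C := by
  have htop (c : ℝ) : Tendsto (fun n : ℕ => c + (n : ℝ)) atTop atTop :=
    tendsto_atTop_add_const_left _ c tendsto_natCast_atTop_atTop
  have hsub (n : ℕ) : (a + n) / τ - (b + n) / τ = (a - b) / τ := by ring
  rcases lt_trichotomy a b with hab | rfl | hab
  · obtain ⟨C, hC⟩ := exists_abs_log_affine_sub_log_le hτ (a - τ)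
    refine ⟨(b - a) / τ * C, ?_⟩
    filter_upwards [hC, (htop a).eventually_gt_atTop τ] with n hn ha
    have h := le_log_Gamma_sub_of_lt ((one_lt_div hτ).2 ha)
      (div_lt_div_of_pos_right (add_lt_add_left hab (n : ℝ)) hτ)
    have he : (a + n) / τ - 1 = (a - τ + n) / τ := by field_simp; ring
    rw [he] at h
    have hpos : 0 < (b - a) / τ := div_pos (sub_pos.2 hab) hτ
    have h1 := mul_le_mul_of_nonneg_left (neg_le_of_abs_le hn) hpos.le
    have h2 : (b + n) / τ - (a + n) / τ = (b - a) / τ := by ring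
    have h3 : (a - b) / τ = -((b - a) / τ) := by ring
    rw [h2] at h
    rw [h3]
    linarith
  · exact ⟨0, by simp⟩
  · obtain ⟨C, hC⟩ := exists_abs_log_affine_sub_log_le hτ a
    refine ⟨(a - b) / τ * C, ?_⟩
    filter_upwards [hC, (htop b).eventually_gt_atTop 0] with n hn hb
    have h := log_Gamma_sub_le_of_lt (div_pos hb hτ)
      (div_lt_div_of_pos_right (add_lt_add_left hab (n : ℝ)) hτ)
    have hpos : 0 < (a - b) / τ := div_pos (sub_pos.2 hab) hτ
    have h1 := mul_le_mul_of_nonneg_left (le_of_abs_le hn) hpos.le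
    rw [hsub] at h
    linarith

lemma tendsto_prod_Gamma_div_Gamma {ι : Type*} [Fintype ι] {τ : ℝ} (hτ : 0 < τ) (a b : ι → ℝ)
    (hab : 0 < ∑ j, (b j - a j)) :
    Tendsto (fun n : ℕ => ∏ j, Real.Gamma ((a j + n) / τ) / Real.Gamma ((b j + n) / τ))
      atTop (nhds 0) := by
  choose C hC using fun j => exists_log_Gamma_sub_le hτ (a j) (b j)
  have hpos (c : ι → ℝ) : ∀ᶠ n : ℕ in atTop, ∀ j, 0 < Real.Gamma ((c j + n) / τ) := by
    refine eventually_all.2 fun j => ?_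
    filter_upwards [(tendsto_atTop_add_const_left _ (c j)
      tendsto_natCast_atTop_atTop).eventually_gt_atTop (0 : ℝ)] with n hn
    exact Real.Gamma_pos_of_pos (div_pos hn hτ)
  have hlim : Tendsto (fun n : ℕ => Real.exp (-((∑ j, (b j - a j)) / τ) * Real.log n + ∑ j, C j))
      atTop (nhds 0) :=
    Real.tendsto_exp_atBot.comp <| tendsto_atBot_add_const_right _ _ <|
      (Real.tendsto_log_atTop.comp tendsto_natCast_atTop_atTop).const_mul_atTop_of_neg
        (neg_neg_of_pos (div_pos hab hτ))
  refine squeeze_zero' ?_ ?_ hlim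
  · filter_upwards [hpos a, hpos b] with n ha hb
    exact Finset.prod_nonneg fun j _ => (div_pos (ha j) (hb j)).le
  · filter_upwards [hpos a, hpos b, eventually_all.2 hC] with n ha hb hn
    have hexp : -((∑ j, (b j - a j)) / τ) * Real.log n + ∑ j, C j =
        ∑ j, ((a j - b j) / τ * Real.log n + C j) := by
      rw [Finset.sum_add_distrib, ← Finset.sum_mul, ← Finset.sum_div, ← neg_div,
        ← Finset.sum_neg_distrib]
      simp only [neg_sub]
    rw [hexp, Real.exp_sum]
    refine Finset.prod_le_prod (fun j _ => (div_pos (ha j) (hb j)).le) fun j _ => ?_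
    rw [← Real.log_le_iff_le_exp (div_pos (ha j) (hb j)),
      Real.log_div (ha j).ne' (hb j).ne']
    exact hn j

lemma summable_mul_pow_of_tendsto_ratio_zero {c r : ℕ → ℂ} (hr : Tendsto r atTop (nhds 0))
    (hc : ∀ n, c (n + 1) = c n * r n) (x : ℂ) : Summable fun n => c n * x ^ n := by
  have h : Tendsto (fun n => ‖r n * x‖) atTop (nhds 0) := by
    simpa using (hr.mul_const x).norm
  refine summable_of_ratio_norm_eventually_le (r := 1 / 2) (by norm_num) ?_
  filter_upwards [h.eventually_le_const (by norm_num : (0 : ℝ) < 1 / 2)] with n hn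
  have he : c (n + 1) * x ^ (n + 1) = (r n * x) * (c n * x ^ n) := by
    rw [hc, pow_succ]; ring
  rw [he, norm_mul]
  exact mul_le_mul_of_nonneg_right hn (norm_nonneg _)

lemma differentiable_tsum_mul_pow {c : ℕ → ℂ} (hc : ∀ x : ℂ, Summable fun n => c n * x ^ n) :
    Differentiable ℂ fun x => ∑' n, c n * x ^ n := by
  intro x
  have h : DifferentiableOn ℂ (fun x => ∑' n, c n * x ^ n) (Metric.ball 0 (‖x‖ + 1)) := by
    refine differentiableOn_tsum_of_summable_norm (hc (‖x‖ + 1 : ℝ)).norm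
      (fun n => by fun_prop) Metric.isOpen_ball fun n w hw => ?_
    have hw' : ‖w‖ ≤ ‖((‖x‖ + 1 : ℝ) : ℂ)‖ := by
      rw [norm_real, Real.norm_of_nonneg (by positivity)]
      exact (mem_ball_zero_iff.1 hw).le
    rw [norm_mul, norm_mul, norm_pow, norm_pow]
    gcongr
  exact h.differentiableAt (Metric.isOpen_ball.mem_nhds (by simp))

/-- The generalized Kilbas–Saigo series has infinite radius of convergence and
defines an entire function. -/
theorem generalized_kilbas_saigo_entire (τ : ℝ) (hτ : 0 < τ) {p : ℕ} (hp : 1 ≤ p)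
    (a b : Fin p → ℝ)
    (ha : ∀ j : Fin p, ∀ m n : ℕ, a j ≠ -(m * τ) - n)
    (hb : ∀ j : Fin p, 0 < b j)
    (hab : 0 < ∑ j, (b j - a j)) :
    (∀ x : ℂ, Summable fun n : ℕ =>
      ((∏ j : Fin p, ∏ k ∈ Finset.range n,
          Real.Gamma ((a j + k) / τ) / Real.Gamma ((b j + k) / τ) : ℝ) : ℂ) * x ^ n) ∧
    Differentiable ℂ (fun x : ℂ => ∑' n : ℕ,
      ((∏ j : Fin p, ∏ k ∈ Finset.range n,
          Real.Gamma ((a j + k) / τ) / Real.Gamma ((b j + k) / τ) : ℝ) : ℂ) * x ^ n) := by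
  have hsum (x : ℂ) := summable_mul_pow_of_tendsto_ratio_zero
    (c := fun n => ((∏ j : Fin p, ∏ k ∈ Finset.range n,
      Real.Gamma ((a j + k) / τ) / Real.Gamma ((b j + k) / τ) : ℝ) : ℂ))
    ((continuous_ofReal.tendsto' 0 0 ofReal_zero).comp (tendsto_prod_Gamma_div_Gamma hτ a b hab))
    (fun n => by
      simp only [Finset.prod_range_succ, Finset.prod_mul_distrib, ofReal_mul, Function.comp_apply])
    x
  exact ⟨hsum, differentiable_tsum_mul_pow hsum⟩
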